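/- Fix l ≥ 1, let Σ_S be given by an asynchronous state space system B_S of trajectories ℕ → Γ × X with external behavior B, and let Σ_S^{l↑} be the canonical state space system for B^{l↑}. Then the following are equivalent: (1) B = B^{l↑} and R_X is an l-initial simulation relation from Σ_S to Σ_S; (2) R_l^{-1} is an l-initial simulation relation from Σ_S^{l↑} to Σ_S. -/

import Mathlib

namespace LComplete

/-- The string `(γ s, γ (s+1), …, γ (s+len-1))`, i.e. the restriction `γ|[s, s+len-1]`. -/
def window {Γ : Type*} (γ : ℕ → Γ) (s len : ℕ) : List Γ :=
  (List.range len).map fun i => γ (s + i)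

/-- The set of restrictions `B|[s, s+len-1]` of all signals in the behavior `B`. -/
def windowSet {Γ : Type*} (B : Set (ℕ → Γ)) (s len : ℕ) : Set (List Γ) :=
  (fun γ => window γ s len) '' B

/-- `(Γ, B)` is asynchronously `m`-complete: a signal belongs to `B` iff its initial
string of length `m` is an initial string of `B` and every sliding window of length
`m+1` occurs somewhere in `B`. -/
def AsyncComplete {Γ : Type*} (m : ℕ) (B : Set (ℕ → Γ)) : Prop :=
  ∀ γ : ℕ → Γ,
    γ ∈ B ↔ (window γ 0 m ∈ windowSet B 0 m ∧
      ∀ k : ℕ, ∃ k' : ℕ, window γ k (m + 1) ∈ windowSet B k' (m + 1))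

/-- The behavior `B^{m↑}` of the strongest asynchronous `m`-complete approximation. -/
def lift {Γ : Type*} (m : ℕ) (B : Set (ℕ → Γ)) : Set (ℕ → Γ) :=
  { γ | window γ 0 m ∈ windowSet B 0 m ∧
      ∀ k : ℕ, ∃ k' : ℕ, window γ k (m + 1) ∈ windowSet B k' (m + 1) }

/-- The concatenation `w₁ ∧_{t₁}^{t₂} w₂`. -/
def concat {V : Type*} (w₁ w₂ : ℕ → V) (t₁ t₂ : ℕ) : ℕ → V :=
  fun t => if t < t₁ then w₁ t else w₂ (t - t₁ + t₂)

/-- `BS` is an asynchronous state space system. -/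
def IsAsyncSS {W X : Type*} (BS : Set ((ℕ → W) × (ℕ → X))) : Prop :=
  ∀ p ∈ BS, ∀ q ∈ BS, ∀ t₁ t₂ : ℕ, p.2 t₁ = q.2 t₂ →
    (concat p.1 q.1 t₁ t₂, concat p.2 q.2 t₁ t₂) ∈ BS

/-- State set `Z'` of the canonical state space system for `B'`. -/
def canonState {Γ : Type*} (l : ℕ) (B' : Set (ℕ → Γ)) : Set (List Γ) :=
  { ζ | (ζ.length < l ∧ ζ ∈ windowSet B' 0 ζ.length) ∨
        (ζ.length = l ∧ ∃ k : ℕ, ζ ∈ windowSet B' k l) }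

/-- Behavior `B'_S` of the canonical state space system for `B'`. -/
def canonBeh {Γ : Type*} (l : ℕ) (B' : Set (ℕ → Γ)) :
    Set ((ℕ → Γ) × (ℕ → List Γ)) :=
  { p | p.1 ∈ B' ∧
      ∀ k : ℕ, p.2 k = if k < l then window p.1 0 k else window p.1 (k - l) l }

/-- The external behavior of a state space behavior. -/
def extBeh {Γ X : Type*} (BS : Set ((ℕ → Γ) × (ℕ → X))) : Set (ℕ → Γ) :=
  { γ | ∃ x : ℕ → X, (γ, x) ∈ BS }

/-- `R` is an `m`-initial simulation relation from the system with behavior `BS₁`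
to the system with behavior `BS₂`. -/
def InitSim {Γ X₁ X₂ : Type*} (m : ℕ) (BS₁ : Set ((ℕ → Γ) × (ℕ → X₁)))
    (BS₂ : Set ((ℕ → Γ) × (ℕ → X₂))) (R : Set (X₁ × X₂)) : Prop :=
  (∀ p ∈ BS₁, ∃ q ∈ BS₂, (p.2 m, q.2 m) ∈ R) ∧
  (∀ p ∈ BS₁, ∀ q' ∈ BS₂, ∀ t₁ t₂ : ℕ, (p.2 t₁, q'.2 t₂) ∈ R →
    ∃ q ∈ BS₂,
      q.1 = concat q'.1 p.1 t₂ t₁ ∧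
      (∀ t ≤ t₂, q.2 t = q'.2 t) ∧
      ∀ j : ℕ, 1 ≤ j → (p.2 (t₁ + j), q.2 (t₂ + j)) ∈ R)

/-- `R` is a synchronous simulation relation from the system with behavior `BS₁`
to the system with behavior `BS₂`. -/
def SyncSim {Γ X₁ X₂ : Type*} (BS₁ : Set ((ℕ → Γ) × (ℕ → X₁)))
    (BS₂ : Set ((ℕ → Γ) × (ℕ → X₂))) (R : Set (X₁ × X₂)) : Prop :=
  (∀ t : ℕ, ∀ p ∈ BS₁, ∃ q ∈ BS₂, (p.2 t, q.2 t) ∈ R) ∧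
  (∀ p ∈ BS₁, ∀ q' ∈ BS₂, ∀ t : ℕ, (p.2 t, q'.2 t) ∈ R →
    ∃ q ∈ BS₂,
      q.1 = concat q'.1 p.1 t t ∧
      (∀ s ≤ t, q.2 s = q'.2 s) ∧
      ∀ j : ℕ, 1 ≤ j → (p.2 (t + j), q.2 (t + j)) ∈ R)

/-- `X^{k,ζ}`: states reached at time `k` with recent past `ζ`. -/
def reachAt {Γ X : Type*} (BS : Set ((ℕ → Γ) × (ℕ → X))) (k : ℕ) (ζ : List Γ) :
    Set X :=
  { ξ | ∃ p ∈ BS, p.2 k = ξ ∧ window p.1 (k - ζ.length) ζ.length = ζ }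

/-- `X_ζ`: states compatible with recent past `ζ`. -/
def reach {Γ X : Type*} (BS : Set ((ℕ → Γ) × (ℕ → X))) (ζ : List Γ) : Set X :=
  { ξ | ∃ k : ℕ, ζ.length ≤ k ∧ ξ ∈ reachAt BS k ζ }

/-- The relation `R₀ ⊆ X × Z'`. -/
def R0 {Γ X : Type*} (l : ℕ) (BS : Set ((ℕ → Γ) × (ℕ → X))) (B : Set (ℕ → Γ)) :
    Set (X × List Γ) :=
  { p | p.2 ∈ canonState l (lift l B) ∧
      ((p.2.length < l ∧ p.1 ∈ reachAt BS p.2.length p.2) ∨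
       (p.2.length = l ∧ p.1 ∈ reach BS p.2)) }

/-- The relation `R_l ⊆ X × Z'`. -/
def Rl {Γ X : Type*} (l : ℕ) (BS : Set ((ℕ → Γ) × (ℕ → X))) (B : Set (ℕ → Γ)) :
    Set (X × List Γ) :=
  { p | p.2 ∈ canonState l (lift l B) ∧ p.2.length = l ∧ p.1 ∈ reach BS p.2 }

/-- The relation `R_X ⊆ X × X`. -/
def RX {Γ X : Type*} (l : ℕ) (BS : Set ((ℕ → Γ) × (ℕ → X))) : Set (X × X) :=
  { p | ∃ ζ : List Γ, ζ.length = l ∧ p.1 ∈ reach BS ζ ∧ p.2 ∈ reach BS ζ }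

/-- The inverse of a relation. -/
def inv {X₁ X₂ : Type*} (R : Set (X₁ × X₂)) : Set (X₂ × X₁) :=
  { p | (p.2, p.1) ∈ R }

/-- The full behavior `B_f(P)` of a state machine `P = (X, W, δ, X₀)`. -/
def fullBeh {W X : Type*} (δ : Set (X × W × X)) (X₀ : Set X) :
    Set ((ℕ → W) × (ℕ → X)) :=
  { p | p.2 0 ∈ X₀ ∧ ∀ t : ℕ, (p.2 t, p.1 t, p.2 (t + 1)) ∈ δ }

/-- The transition relation `δ` of the canonical realization of `B'`. -/
def canonDelta {Γ : Type*} (l : ℕ) (B' : Set (ℕ → Γ)) :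
    Set (List Γ × Γ × List Γ) :=
  { t | (t.1.length < l ∧ t.2.2 = t.1 ++ [t.2.1] ∧
          t.1 ++ [t.2.1] ∈ windowSet B' 0 (t.1.length + 1)) ∨
        (t.1.length = l ∧ t.2.2 = t.1.tail ++ [t.2.1] ∧
          ∃ k' : ℕ, t.1 ++ [t.2.1] ∈ windowSet B' k' (l + 1)) }

end LComplete

namespace LComplete

variable {Γ V X : Type*}

@[simp]
lemma length_window (γ : ℕ → Γ) (s n : ℕ) : (window γ s n).length = n := by
  simp [window]

lemma window_eq_window_iff {γ γ' : ℕ → Γ} {s s' n : ℕ} :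
    window γ s n = window γ' s' n ↔ ∀ i < n, γ (s + i) = γ' (s' + i) := by
  simp [window, List.map_inj_left]

lemma concat_of_lt (w v : ℕ → V) {t₁ t : ℕ} (t₂ : ℕ) (h : t < t₁) :
    concat w v t₁ t₂ t = w t := if_pos h

lemma concat_add (w v : ℕ → V) (t₁ t₂ j : ℕ) :
    concat w v t₁ t₂ (t₁ + j) = v (t₂ + j) := by
  simp [concat, add_comm]

lemma window_concat (w v : ℕ → Γ) {t₁ l : ℕ} (t₂ : ℕ) (h : l ≤ t₁) :
    window (concat w v t₁ t₂) (t₁ - l) l = window w (t₁ - l) l :=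
  window_eq_window_iff.2 fun _ _ => concat_of_lt _ _ _ (by omega)

lemma subset_lift (m : ℕ) (B : Set (ℕ → Γ)) : B ⊆ lift m B :=
  fun γ hγ => ⟨⟨γ, hγ, rfl⟩, fun k => ⟨k, γ, hγ, rfl⟩⟩

/-- The state trajectory of the canonical state space system along the signal `γ`. -/
def canonTraj (l : ℕ) (γ : ℕ → Γ) (k : ℕ) : List Γ :=
  if k < l then window γ 0 k else window γ (k - l) l

lemma canonTraj_of_le {l k : ℕ} (γ : ℕ → Γ) (h : l ≤ k) :
    canonTraj l γ k = window γ (k - l) l := if_neg (by omega)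

lemma mem_canonBeh {l : ℕ} {B : Set (ℕ → Γ)} {γ : ℕ → Γ} (h : γ ∈ B) :
    (γ, canonTraj l γ) ∈ canonBeh l B := ⟨h, fun _ => rfl⟩

lemma eq_canonTraj_of_mem_canonBeh {l : ℕ} {B : Set (ℕ → Γ)} {p : (ℕ → Γ) × (ℕ → List Γ)}
    (h : p ∈ canonBeh l B) : p.2 = canonTraj l p.1 := funext h.2

lemma le_of_length_canonTraj {l k : ℕ} {γ : ℕ → Γ} (h : (canonTraj l γ k).length = l) :
    l ≤ k := by
  by_contra! hk
  simp only [canonTraj, if_pos hk, length_window] at h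
  omega

lemma window_mem_canonState {l : ℕ} {B : Set (ℕ → Γ)} {γ : ℕ → Γ} (h : γ ∈ B) (k : ℕ) :
    window γ k l ∈ canonState l B :=
  Or.inr ⟨length_window _ _ _, k, γ, h, rfl⟩

lemma mem_reach_window {BS : Set ((ℕ → Γ) × (ℕ → X))} {p : (ℕ → Γ) × (ℕ → X)}
    (hp : p ∈ BS) {l k : ℕ} (h : l ≤ k) : p.2 k ∈ reach BS (window p.1 (k - l) l) :=
  ⟨k, by simpa using h, p, hp, rfl, by simp⟩

/-- If the state of `q` at time `t` is compatible with the recent past of `γ` at time `s` and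
`q` follows `γ` from then on, then all later states of `q` are compatible with the recent past
of `γ` at the corresponding times. -/
lemma IsAsyncSS.mem_reach_window_add {BS : Set ((ℕ → Γ) × (ℕ → X))} (hBS : IsAsyncSS BS)
    {q : (ℕ → Γ) × (ℕ → X)} (hq : q ∈ BS) {γ : ℕ → Γ} {l s t : ℕ} (hs : l ≤ s)
    (hreach : q.2 t ∈ reach BS (window γ (s - l) l))
    (hγ : ∀ j, q.1 (t + j) = γ (s + j)) (j : ℕ) :
    q.2 (t + j) ∈ reach BS (window γ (s + j - l) l) := by
  obtain ⟨k, hk, p, hp, hpk, hw⟩ := hreach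
  simp only [length_window] at hk hw
  have h := mem_reach_window (hBS p hp q hq k t hpk) (l := l) (k := k + j) (by omega)
  simp only [concat_add] at h
  convert h using 2
  refine window_eq_window_iff.2 fun i hi => ?_
  rcases lt_or_ge (j + i) l with hlt | hge
  · rw [concat_of_lt _ _ _ (by omega)]
    have := window_eq_window_iff.1 hw (j + i) hlt
    rw [show k + j - l + i = k - l + (j + i) by omega, this]
    congr 1
    omega
  · rw [show k + j - l + i = k + (j + i - l) by omega, concat_add, hγ]
    congr 1
    omega

lemma initSim_inv_Rl {BS : Set ((ℕ → Γ) × (ℕ → X))} (hBS : IsAsyncSS BS) {l : ℕ}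
    (hlift : extBeh BS = lift l (extBeh BS)) (hRX : InitSim l BS BS (RX l BS)) :
    InitSim l (canonBeh l (lift l (extBeh BS))) BS (inv (Rl l BS (extBeh BS))) := by
  refine ⟨fun p hp => ?_, fun p hp q' hq' t₁ t₂ hR => ?_⟩
  · obtain ⟨x, hx⟩ : p.1 ∈ extBeh BS := hlift ▸ hp.1
    refine ⟨(p.1, x), hx, ?_⟩
    rw [eq_canonTraj_of_mem_canonBeh hp, canonTraj_of_le _ le_rfl]
    exact ⟨window_mem_canonState hp.1 _, length_window _ _ _, mem_reach_window hx le_rfl⟩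
  · rw [eq_canonTraj_of_mem_canonBeh hp] at hR ⊢
    obtain ⟨-, hlen, hreach⟩ := hR
    have ht₁ := le_of_length_canonTraj hlen
    simp only [canonTraj_of_le _ ht₁] at hreach
    obtain ⟨x, hx⟩ : p.1 ∈ extBeh BS := hlift ▸ hp.1
    obtain ⟨q, hq, hq₁, hq₂, -⟩ := hRX.2 (p.1, x) hx q' hq' t₁ t₂
      ⟨_, length_window _ _ _, mem_reach_window hx ht₁, hreach⟩
    refine ⟨q, hq, hq₁, hq₂, fun j _ => ?_⟩
    rw [canonTraj_of_le _ (by omega)]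
    refine ⟨window_mem_canonState hp.1 _, length_window _ _ _,
      hBS.mem_reach_window_add hq ht₁ (by rwa [hq₂ t₂ le_rfl]) (fun i => ?_) j⟩
    rw [hq₁, concat_add]

lemma extBeh_eq_lift_of_initSim {BS : Set ((ℕ → Γ) × (ℕ → X))} {l : ℕ}
    (h : InitSim l (canonBeh l (lift l (extBeh BS))) BS (inv (Rl l BS (extBeh BS)))) :
    extBeh BS = lift l (extBeh BS) := by
  refine (subset_lift _ _).antisymm fun γ hγ => ?_
  obtain ⟨γ', ⟨x', hx'⟩, hw⟩ := hγ.1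
  have hw : window γ' 0 l = window γ 0 l := hw
  have hreach := mem_reach_window hx' (le_refl l)
  simp only [Nat.sub_self, hw] at hreach
  obtain ⟨q, hq, hq₁, -⟩ := h.2 _ (mem_canonBeh hγ) _ hx' l l (by
    simp only [canonTraj_of_le _ le_rfl, Nat.sub_self]
    exact ⟨window_mem_canonState hγ _, length_window _ _ _, hreach⟩)
  have : q.1 = γ := by
    rw [hq₁]
    funext t
    rcases lt_or_ge t l with ht | ht
    · rw [concat_of_lt _ _ _ ht]
      simpa using window_eq_window_iff.1 hw t ht
    · obtain ⟨j, rfl⟩ := Nat.exists_eq_add_of_le ht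
      rw [concat_add]
  exact ⟨q.2, this ▸ hq⟩

lemma initSim_RX {BS : Set ((ℕ → Γ) × (ℕ → X))} (hBS : IsAsyncSS BS) {l : ℕ}
    (h : InitSim l (canonBeh l (lift l (extBeh BS))) BS (inv (Rl l BS (extBeh BS)))) :
    InitSim l BS BS (RX l BS) := by
  refine ⟨fun p hp => ⟨p, hp, _, length_window _ _ _, mem_reach_window hp le_rfl,
    mem_reach_window hp le_rfl⟩, ?_⟩
  rintro p hp q' hq' t₁ t₂ ⟨ζ, hζ, ⟨k, hk, p₀, hp₀, hpk, hw⟩, hq'ζ⟩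
  rw [hζ] at hk hw
  have hp₁ := hBS p₀ hp₀ p hp k t₁ hpk
  have hlift := subset_lift l (extBeh BS) ⟨_, hp₁⟩
  obtain ⟨q, hq, hq₁, hq₂, hq₃⟩ := h.2 _ (mem_canonBeh hlift) q' hq' k t₂ (by
    simp only [canonTraj_of_le _ hk]
    refine ⟨window_mem_canonState hlift _, length_window _ _ _, ?_⟩
    simpa only [window_concat _ _ _ hk, hw] using hq'ζ)
  refine ⟨q, hq, hq₁.trans ?_, hq₂, fun j hj => ?_⟩
  · funext t
    rcases lt_or_ge t t₂ with ht | ht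
    · rw [concat_of_lt _ _ _ ht, concat_of_lt _ _ _ ht]
    · obtain ⟨j, rfl⟩ := Nat.exists_eq_add_of_le ht
      simp only [concat_add]
  · obtain ⟨-, hlen, hreach⟩ := hq₃ j hj
    refine ⟨_, hlen, ?_, hreach⟩
    have hkj : l ≤ k + j := by omega
    have := mem_reach_window hp₁ hkj
    simp only [concat_add] at this
    simpa only [canonTraj_of_le _ hkj] using this

end LComplete

/-- `B = B^{l↑}` together with `R_X` being an `l`-initial simulation
relation from `Σ_S` to itself holds iff `R_l⁻¹` is an `l`-initial simulation relation
from `Σ_S^{l↑}` to `Σ_S`. -/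
theorem Rl_inv_initSim_iff {Γ X : Type*} [Nonempty Γ] (l : ℕ) (hl : 1 ≤ l)
    (BS : Set ((ℕ → Γ) × (ℕ → X))) (hBS : LComplete.IsAsyncSS BS)
    (B : Set (ℕ → Γ)) (hB : B = LComplete.extBeh BS) :
    (B = LComplete.lift l B ∧ LComplete.InitSim l BS BS (LComplete.RX l BS)) ↔
      LComplete.InitSim l (LComplete.canonBeh l (LComplete.lift l B)) BS
        (LComplete.inv (LComplete.Rl l BS B)) := by
  subst hB
  exact ⟨fun h => LComplete.initSim_inv_Rl hBS h.1 h.2,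
    fun h => ⟨LComplete.extBeh_eq_lift_of_initSim h, LComplete.initSim_RX hBS h⟩⟩
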